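/- Let C ∈ ℤ^{9×9} be the symmetric matrix with rows (4,2,2,1,1,2,2,1,1), (2,4,2,1,2,1,1,2,1), (2,2,4,2,1,1,1,1,2), (1,1,2,4,1,2,1,2,2), (1,2,1,1,4,1,2,2,2), (2,1,1,2,1,4,2,2,1), (2,1,1,1,2,2,4,1,2), (1,2,1,2,2,2,1,4,1), (1,1,2,2,2,1,2,1,4). Then there is no positive definite integral quadratic form q(x₁,…,x₉) = Σ_{1≤i≤j≤9} q_{ij} x_i x_j such that Σ_{1≤i≤j≤9} q_{ij}·C_{ij} ≤ 16. -/

import Mathlib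

open Matrix

/-- The Cartan matrix of the principal 2-block of `C₂⁴ ⋊ A`, `A ∈ Syl₃(Aut(C₂⁴))`. -/
def CartanC : Matrix (Fin 9) (Fin 9) ℤ :=
  !![4,2,2,1,1,2,2,1,1;
     2,4,2,1,2,1,1,2,1;
     2,2,4,2,1,1,1,1,2;
     1,1,2,4,1,2,1,2,2;
     1,2,1,1,4,1,2,2,2;
     2,1,1,2,1,4,2,2,1;
     2,1,1,1,2,2,4,1,2;
     1,2,1,2,2,2,1,4,1;
     1,1,2,2,2,1,2,1,4]

/-- An integral quadratic form `Σ_{i ≤ j} q_{ij} x_i x_j` given by its upper-triangular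
coefficients is positive definite if it is positive on all nonzero real vectors. -/
def QFPosDef {l : ℕ} (q : Fin l → Fin l → ℤ) : Prop :=
  ∀ x : Fin l → ℝ, x ≠ 0 → 0 < ∑ i, ∑ j, if i ≤ j then (q i j : ℝ) * x i * x j else 0

/-- The Gram matrices of arrays of sixteen roots of norm `2`, indexed by `Fin 4 × Fin 4`, whose rows
and columns sum to zero and satisfy no further linear relations. -/
structure IsRootArray (h : Fin 4 → Fin 4 → Fin 4 → Fin 4 → ℤ) : Prop where
  norm : ∀ i j, h i j i j = 2
  symm : ∀ i j k l, h i j k l = h k l i j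
  bound : ∀ i j k l, ¬(i = k ∧ j = l) → -1 ≤ h i j k l ∧ h i j k l ≤ 1
  row_sum : ∀ i j k, ∑ l, h i j k l = 0
  col_sum : ∀ i j l, ∑ k, h i j k l = 0
  pos : ∀ a : Fin 4 → Fin 4 → ℤ, (∃ i j k l, a i j + a k l ≠ a i l + a k j) →
    0 < ∑ i, ∑ j, ∑ k, ∑ l, a i j * a k l * h i j k l

namespace IsRootArray

variable {h : Fin 4 → Fin 4 → Fin 4 → Fin 4 → ℤ}

theorem perm (H : IsRootArray h) (σ τ : Equiv.Perm (Fin 4)) :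
    IsRootArray fun i j k l => h (σ i) (τ j) (σ k) (τ l) where
  norm _ _ := H.norm _ _
  symm _ _ _ _ := H.symm _ _ _ _
  bound i j k l hne := H.bound _ _ _ _ fun e => hne ⟨σ.injective e.1, τ.injective e.2⟩
  row_sum i j k := (Equiv.sum_comp τ fun l => h (σ i) (τ j) (σ k) l).trans (H.row_sum _ _ _)
  col_sum i j l := (Equiv.sum_comp σ fun k => h (σ i) (τ j) k (τ l)).trans (H.col_sum _ _ _)
  pos a := by
    rintro ⟨i, j, k, l, hne⟩
    have := H.pos (fun i j => a (σ.symm i) (τ.symm j)) ⟨σ i, τ j, σ k, τ l, by simpa using hne⟩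
    rw [← Equiv.sum_comp σ] at this
    refine this.trans_eq (Finset.sum_congr rfl fun i _ => ?_)
    rw [← Equiv.sum_comp τ]
    refine Finset.sum_congr rfl fun j _ => ?_
    rw [← Equiv.sum_comp σ]
    refine Finset.sum_congr rfl fun k _ => ?_
    rw [← Equiv.sum_comp τ]
    simp

theorem transpose (H : IsRootArray h) : IsRootArray fun i j k l => h j i l k where
  norm _ _ := H.norm _ _
  symm _ _ _ _ := H.symm _ _ _ _
  bound i j k l hne := H.bound _ _ _ _ fun e => hne e.symm
  row_sum _ _ _ := H.col_sum _ _ _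
  col_sum _ _ _ := H.row_sum _ _ _
  pos a := by
    rintro ⟨i, j, k, l, hne⟩
    have := H.pos (fun i j => a j i) ⟨j, i, l, k, by rwa [add_comm (a k j)]⟩
    rw [Finset.sum_comm] at this
    refine this.trans_eq (Finset.sum_congr rfl fun i _ => Finset.sum_congr rfl fun j _ => ?_)
    exact Finset.sum_comm

theorem row_relations (H : IsRootArray h) (i : Fin 4) :
    h i 0 i 1 + h i 0 i 2 + h i 0 i 3 = -2 ∧
      h i 1 i 2 = h i 0 i 3 ∧ h i 1 i 3 = h i 0 i 2 ∧ h i 2 i 3 = h i 0 i 1 := by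
  have s := fun j => H.row_sum i j i
  simp only [Fin.sum_univ_four] at s
  have s0 := s 0
  have s1 := s 1
  have s2 := s 2
  have s3 := s 3
  rw [H.norm] at s0 s1 s2 s3
  rw [H.symm i 1 i 0] at s1
  rw [H.symm i 2 i 0, H.symm i 2 i 1] at s2
  rw [H.symm i 3 i 0, H.symm i 3 i 1, H.symm i 3 i 2] at s3
  omega

theorem exists_orthogonal (H : IsRootArray h) (i j : Fin 4) : ∃ l, l ≠ j ∧ h i j i l = 0 := by
  by_contra! hne
  have s := H.row_sum i j i
  have b : ∀ l, l ≠ j → h i j i l ≤ -1 ∨ 1 ≤ h i j i l := fun l hl => by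
    have := hne l hl
    omega
  have c : ∀ l, l ≠ j → -1 ≤ h i j i l ∧ h i j i l ≤ 1 := fun l hl =>
    H.bound _ _ _ _ fun e => hl e.2.symm
  have n := H.norm i j
  rw [Fin.sum_univ_four] at s
  fin_cases j <;>
  · simp only [Fin.zero_eta, Fin.mk_one, Fin.reduceFinMk] at *
    have b0 := b 0
    have b1 := b 1
    have b2 := b 2
    have b3 := b 3
    have c0 := c 0
    have c1 := c 1
    have c2 := c 2
    have c3 := c 3
    simp at b0 b1 b2 b3 c0 c1 c2 c3
    omega

/-- Each row is determined by one of the three perfect matchings of its entries. -/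
theorem exists_similar_rows (H : IsRootArray h) :
    ∃ i i', i ≠ i' ∧ ∀ j l, h i j i l = h i' j i' l := by
  obtain ⟨i, i', hne, he⟩ := Fintype.exists_ne_map_eq_of_card_lt
    (fun i => if h i 0 i 1 = 0 then (0 : Fin 3) else if h i 0 i 2 = 0 then 1 else 2) (by simp)
  refine ⟨i, i', hne, ?_⟩
  have b := fun i => H.bound i 0 i 1 (by simp)
  have c := fun i => H.bound i 0 i 2 (by simp)
  have d := fun i => H.bound i 0 i 3 (by simp)
  obtain ⟨r0, r1, r2, r3⟩ := H.row_relations i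
  obtain ⟨r0', r1', r2', r3'⟩ := H.row_relations i'
  have key : h i 0 i 1 = h i' 0 i' 1 ∧ h i 0 i 2 = h i' 0 i' 2 := by
    have := b i
    have := b i'
    have := c i
    have := c i'
    have := d i
    have := d i'
    split_ifs at he <;> omega
  have up : ∀ j l, j ≤ l → h i j i l = h i' j i' l := by
    intro j l hjl
    fin_cases j <;> fin_cases l <;>
      simp only [Fin.zero_eta, Fin.mk_one, Fin.reduceFinMk, H.norm] at * <;>
      omega
  intro j l
  rcases le_total j l with hjl | hjl
  · exact up j l hjl
  · rw [H.symm i, H.symm i', up l j hjl]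

end IsRootArray

theorem exists_perm_apply_eq : ∀ j j' l : Fin 4, j ≠ j' → l ≠ j →
    ∃ τ : Equiv.Perm (Fin 4), τ 0 = j ∧ τ 1 = j' ∧ (τ 1 = l ∨ τ 2 = l) := by
  decide +kernel

/-- Two rows and two columns of the array can be assumed to have the same inner products. -/
theorem IsRootArray.exists_normalized {h : Fin 4 → Fin 4 → Fin 4 → Fin 4 → ℤ}
    (H : IsRootArray h) :
    ∃ g, IsRootArray g ∧ (∀ j l, g 1 j 1 l = g 0 j 0 l) ∧ (∀ i k, g i 1 k 1 = g i 0 k 0) ∧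
      (g 0 0 0 1 = 0 ∨ g 0 0 0 2 = 0) ∧ (g 0 0 1 0 = 0 ∨ g 0 0 2 0 = 0) := by
  obtain ⟨i, i', hi, hrow⟩ := H.exists_similar_rows
  obtain ⟨j, j', hj, hcol⟩ := H.transpose.exists_similar_rows
  obtain ⟨l, hl, hl0⟩ := H.exists_orthogonal i j
  obtain ⟨k, hk, hk0⟩ := H.transpose.exists_orthogonal j i
  obtain ⟨σ, rfl, rfl, hσ⟩ := exists_perm_apply_eq i i' k hi hk
  obtain ⟨τ, rfl, rfl, hτ⟩ := exists_perm_apply_eq j j' l hj hl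
  refine ⟨_, H.perm σ τ, fun _ _ => (hrow _ _).symm, fun _ _ => (hcol _ _).symm, ?_, ?_⟩
  · exact hτ.imp (fun e => by rw [e, hl0]) fun e => by rw [e, hl0]
  · exact hσ.imp (fun e => by rw [e]; exact hk0) fun e => by rw [e]; exact hk0

/-- The free entries of the Gram matrix of the nine roots, in the order in which the search assigns
them. The entry `(a, b, c, d)` stands for the inner product of the roots `a` and `b`, and `(c, d)`
is the entry that gets eliminated by means of a linear relation involving `(a, b)`. -/
def freeEntries : List (ℕ × ℕ × ℕ × ℕ) :=
  [(0, 1, 1, 2), (0, 2, 1, 2), (3, 4, 4, 5), (3, 5, 4, 5), (0, 3, 3, 6), (0, 6, 3, 6),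
   (1, 4, 4, 7), (1, 7, 4, 7), (5, 7, 0, 5), (1, 5, 0, 5), (3, 7, 0, 5), (1, 3, 0, 5),
   (1, 6, 0, 5), (1, 8, 0, 5), (3, 8, 0, 5), (2, 3, 0, 5), (2, 6, 0, 5), (5, 8, 2, 8),
   (2, 5, 2, 8), (2, 7, 0, 5), (2, 4, 0, 5), (4, 8, 0, 5), (7, 8, 6, 8), (6, 7, 6, 8),
   (4, 6, 0, 5), (5, 6, 0, 5), (0, 8, 0, 5), (0, 7, 0, 5), (0, 4, 0, 5)]

/-- The decimal digit with index `i` of `n`. -/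
def digit (n i : ℕ) : ℕ := n / Nat.pow 10 i % 10

/-- The coordinate with index `i` of the vector in `ℤ⁹` encoded by the decimal digits of `n`:
a digit `d` stands for the entry `d - 4`. -/
def coord (n i : ℕ) : ℤ := digit n i - 4

/-- The positive part of the expansion of the coefficient of a free entry. -/
def posCoeff (e : ℕ × ℕ × ℕ × ℕ) (n : ℕ) : ℕ :=
  digit n e.1 * digit n e.2.1 + 4 * (digit n e.2.2.1 + digit n e.2.2.2)

/-- The negative part of the expansion of the coefficient of a free entry. -/
def negCoeff (e : ℕ × ℕ × ℕ × ℕ) (n : ℕ) : ℕ :=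
  digit n e.2.2.1 * digit n e.2.2.2 + 4 * (digit n e.1 + digit n e.2.1)

/-- The constant term of the value of the quadratic form at the vector encoded by `n`, as a function
of the free entries. -/
def constTerm (n : ℕ) : ℤ :=
  coord n 0 ^ 2 + coord n 1 ^ 2 + coord n 2 ^ 2 + coord n 3 ^ 2 + coord n 4 ^ 2 + coord n 5 ^ 2 +
    coord n 6 ^ 2 + coord n 7 ^ 2 + coord n 8 ^ 2 -
    2 * (coord n 1 * coord n 2 + coord n 4 * coord n 5 + coord n 6 * coord n 8 +
      coord n 3 * coord n 6 + coord n 4 * coord n 7 + coord n 2 * coord n 8) +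
    4 * (coord n 0 * coord n 5)

/-- Vectors such that no Gram matrix under consideration is positive on all of them. -/
def testVectors : List ℕ :=
  [454554444, 454554454, 444554454, 454344454, 454455444, 454555444, 434545444, 444555454,
   454565454, 454455454, 454555454, 454343454, 444343454, 454453454, 444333454, 454443454,
   445445455, 443443454, 445444455, 333444454, 555555545, 544544554, 777444474, 555445444,
   344443454, 544443454, 333443454, 555445454, 555443454, 344445454, 544543544, 444445555,
   555556545, 444443554, 555554565, 544545544, 555554545, 544545554, 544543554, 555554555,
   444445545, 344343354, 443443554, 445445555, 443444554, 445444555, 443443544, 445444545,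
   445445545, 344344454, 344343454, 544545444, 344345454, 544444554, 544444544, 544443554,
   444343554, 444544554, 544445554, 444545544, 544443544, 444545554, 434544544, 555444544,
   454343554, 555445544, 555444554, 454443554, 333443544, 434545544, 434445544, 555445554,
   333444544, 454443544, 454444554, 434443554, 555443544, 454445554, 444454554, 555555445,
   444433544, 454454554, 555555455, 434434544, 555556455, 444555544, 444555554, 444554554,
   454455554, 434433544, 454555544, 555554455, 444333544, 444554544, 434333544, 555554445,
   454554554, 434555554, 444455554, 454453554, 454565554, 434555544, 555555655, 434435544,
   444433554, 454555554, 555554655, 344455444, 544554554, 544555554, 544554444, 544434544,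
   544433544, 344454454, 544555444, 544554544, 344455454, 544434554, 544555544, 344333454,
   344334454, 544655554, 544655544, 544433554, 544555454, 344455354, 344555444, 344555454,
   334445444, 534544544, 534545544, 354344454, 554454454, 354343454, 554454444, 554454554,
   554444554, 554565454, 554443554, 554433544, 554343454, 554444544, 554443544, 534434544,
   554554444, 554554554, 554544544, 354455454, 534433544, 334333454, 334455554, 554443454,
   554555544, 354454454, 334433554, 554444454, 354355454, 554565554, 354453354, 554343554,
   554453554, 554543544, 334545444, 554453454, 554544554, 554655544, 554553454, 554554544,
   354565354, 554555454, 554455454, 554543554, 554555554, 334545554, 554655554, 334445454,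
   334555454, 334343554, 554553654, 554545554, 334435444, 554553544, 545444544, 453443554,
   545444444, 545445544, 545445444, 433444544, 543443544, 455445544, 545444554, 343443454,
   453443454, 433443554, 433444554, 343443554, 343444554, 455445444, 455444554, 433443544,
   343444454, 455444454, 455445454, 545445454, 543443554, 445455444, 443454454, 555455444,
   343454454, 443454554, 443433544, 555454554, 545434544, 543433554, 543433544, 455454554,
   555454444, 555454454, 455455444, 433433544, 555455554, 343454554, 555455454, 555434544,
   455454454, 565454554, 343453454, 343454444, 453454554, 455455454, 445455544, 343453554,
   565455454, 565455554, 333433544, 453454454, 443453554, 545435444, 343455454, 555434554,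
   533433544, 445434544, 443453454, 433434544, 445455454, 333434544, 565454454, 545435554,
   455454444, 445454554, 343455354, 443433554, 443434554, 443453544, 433544444, 545544544,
   343343454, 445555444, 554554555, 343344454, 343354454, 545545544, 453343454, 545555544,
   554555555, 554555565, 555344454, 455355454, 545555444, 443544544, 455344454, 555545544,
   455555554, 445555544, 433544544, 545555554, 443554554, 554555545, 443343454, 545545444,
   555555544, 545534544, 555544544, 555565554, 355345454, 443333454, 555554544, 453343554,
   545544554, 443343554, 455354454, 556555445, 433543544, 443543554, 545544444, 333544444,
   333344454, 433543554, 555544554, 555565454, 543554544, 545655544, 556555455, 554555655,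
   443554444, 655554544, 443543544, 655554554, 443554454, 555554554, 556555555, 443554544,
   343554444, 543553454, 545333454, 655545544, 332333454, 565554554, 655543544, 555555444,
   555554444, 555555554, 555544444, 455343354, 565555554, 556555545, 555545444, 555655554,
   433333544, 554554545, 433544554, 445545444, 445344454, 443544554, 455565454, 433534544,
   433554544, 343554554, 555655544, 443333544, 555545554, 655545554, 343554454, 543544554,
   555554454, 455565554, 353343454, 543554554, 543544544, 445545544, 455555454, 345355454,
   443344454, 655555554, 565555454, 545655554, 453554454, 655544554, 453554554, 455554454,
   333343454, 545535544, 455344354, 554554655, 445544554, 655555544, 555545454, 445545454,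
   333334454, 565554454, 455555444, 545545554, 343333454, 553543454, 433545544, 443543454,
   555555454, 445334454, 554555455, 233344354, 445555454, 343344354, 353565454, 455555556,
   655555556, 544445555, 544445455, 545445555, 344445455, 545445455, 344445445, 544444555,
   344444455, 454555555, 455556545, 545444455, 454554455, 545445445, 455555445, 545445545,
   343444455, 455555565, 233334345, 544445545, 454555445, 655556545, 655554555, 426224446,
   455554565, 454555565, 454554555, 545444555, 344445345, 655556655, 455556455, 345445445,
   454555455, 544444545, 345445455, 344445555, 455555545, 434334445, 344444555, 455556555,
   434334545, 455555455, 433334455, 655554565, 455555555, 454554565, 655555545, 455556445,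
   455554555, 546445545, 454554445, 545444445, 434335345, 545444655, 546445345, 543444655,
   434333435, 545444545, 545444435, 544443545, 656555565, 444555555, 554444555, 454444555,
   555445555, 555444555, 545555555, 455445445, 444555445, 544555555, 544554555, 445556545,
   455445555, 434445555, 555445545, 445555455, 455334445, 455444555, 545556555, 445555555,
   555445445, 455444455, 554444455, 545555445, 445334455, 545555655, 556444565, 444334445,
   435445445, 545556455, 344334455, 544555545, 444555455, 434555545, 555444455, 555445455,
   545555545, 556445455, 556445555, 344555445, 334444455, 556445445, 434555445, 345334455,
   544554445, 445335345, 334444445, 334445455, 455445345, 435445545, 455444545, 444334545,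
   354444345, 544555445, 233444345, 545556655, 334224345, 344334445, 343554455, 444554555,
   445334545, 434445445, 544554545, 455334345, 545556445, 566445565, 545555556, 555444445,
   565554555, 455445455, 334445445, 434444545, 433444545, 344555455, 545556545, 434444555,
   334224435, 445555445, 556445545, 554444545, 565555555, 543554655, 445556455, 445555545,
   556444655, 454444455, 344334345, 555445565, 444554545, 444554455, 445334445, 655444655,
   444334455, 565554455, 345334445, 444555545, 565555455, 544554655, 544555655, 534444655,
   345556455, 455444445, 334445545, 565554655, 554664565, 545334455, 655444565, 545555455,
   555444545, 433554455, 545334545, 566555455, 334445345, 434445545, 545334445, 545554655,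
   545554435, 434443545, 334444435, 545334435, 445555435, 545554545, 334444545, 445335435,
   545334655, 564443565, 343554545, 565444655, 554664655, 454445545, 343334545, 345556345,
   455445545, 454443565, 554444655, 454333455, 445334345, 454344455, 545545545, 445545445,
   444455455, 545545445, 555455455, 434545445, 555455555, 455455555, 544544555, 545544555,
   454455555, 455455455, 444545545, 445545545, 554454555, 334434445, 444455555, 434545545,
   344455455, 544545545, 555545556, 545545555, 344344455, 455345445, 544544545, 554454455,
   445545555, 454455455, 554565555, 544434445, 455345455, 434544555, 444544555, 555454565,
   555434545, 344455445, 556545555, 555545545, 445344345, 534545545, 445435545, 555544555,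
   344434445, 454454455, 455565555, 555545555, 555545445, 445455555, 555544545, 555454455,
   445434555, 545434555, 434545555, 435545545, 455565455, 544545555, 544434545, 344345455,
   455344455, 444344455, 544655545, 554544555, 334435445, 454565455, 345455455, 344454455,
   554565455, 555565555, 555455445, 445544545, 565454555, 434434445, 545435545, 545545655,
   545655545, 565455555, 434435545, 554544545, 545655555, 334545445, 354344455, 545435445,
   544545445, 554544445, 443544555, 455454565, 444454555, 434534545, 454455565, 334455345,
   343354455, 544434555, 433534545, 455455445, 334344345, 655534545, 655545555, 555545655,
   556545455, 554655545, 646545545, 555455565, 334545435, 433434555, 555565455, 555454555,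
   534544545, 444434545, 454564565, 455566445, 343544445, 545535656, 556435556, 554455555,
   455466345, 556455565, 655544545, 445566565, 565454455, 243344345, 443564565, 545534545,
   655534655, 554454565, 556545445, 555566565, 655565555, 545546645, 565455455, 544655555,
   545455445, 555655545, 334345455, 434433555, 454454555, 445455455, 545434545, 445345445,
   344344445, 443434545, 433544545, 544534545, 354454455, 435545445, 353454565, 535434545,
   546545445, 534435545, 556455455, 445434445, 556455555, 434544545, 435434545, 354455455,
   454344555, 555544655, 554655655, 556545545, 555344455, 454354455, 444344555, 554455565,
   455344445, 555344445, 334324445, 444655655, 334344445, 434434545, 445455345, 345455445,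
   444344445, 444544445, 333434445, 455454455, 334545545, 545434445, 344345445, 246244466,
   344454445, 555434445, 445345455, 455454555, 443454555, 545546555, 554454445, 344455555,
   434435445, 454455445, 334455445, 554564555, 344454555, 333344445, 545544545, 555655555,
   435434445, 554545655, 545655655, 556345455, 444544545, 344354455, 545455556, 343454455,
   454344445, 334435545, 444545555, 344455345, 455545556, 354565455, 343454445, 544545655,
   354343455, 555565445, 556455445, 455454445, 566455555, 344454345, 556545655, 445344445,
   334434545, 534545655, 455344345, 655544555, 434544445, 323324445, 544544655, 455344555,
   565566445, 554655555, 655545545, 454565555, 334344455, 555455556, 445455445, 455466565,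
   645546545, 545534655, 444434555, 354455345, 454355345, 756545655, 555544445, 333454455,
   554544655, 656535545, 455545555, 344355345, 534434545, 455354455, 556435545, 534544445,
   554344445, 556566445, 545544445, 554564665, 545544655, 343344455, 444545445, 324323445,
   536435545, 535545656, 546345445, 445344555, 445344435, 445454545, 334343435, 555454545,
   445434545, 355344455, 434323445, 556455345, 534433545, 545646435, 565354455, 565354565,
   434535435, 433434545, 445546435, 554343655, 434324435, 545646655, 555454445, 544454555,
   556345556, 454343445, 334345445, 535656545, 344343445, 534655545, 554453545, 536545435,
   445435445, 546645545, 354455565, 335434345, 445544555, 466455455, 445434345, 445544455,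
   454453555, 445344455, 434544435, 566565445, 556655545, 546545645, 445435555, 355454345,
   556455545, 345344445]

/-- Packs a list of numbers into one number, using eight bits for each of them. -/
def pack : List ℕ → ℕ
  | [] => 0
  | d :: ds => d + 256 * pack ds

/-- The product `(p - q) * (t - 1)` for `t ≤ 2`, shifted by `|p - q|` so as to be nonnegative. -/
def shiftedTerm (p q t : ℕ) : ℕ := (p - q) * t + (q - p) * (2 - t)

/-- For every free entry, the packed contributions of its possible values to the accumulator, and a
mask for the test vectors whose remaining coefficients are zero. -/
def searchLevels : List ((ℕ × ℕ × ℕ × ℕ) × List ℕ) → List (List ℕ × ℕ)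
  | [] => []
  | (e, dom) :: es =>
    (dom.map fun t => pack (testVectors.map fun n => shiftedTerm (posCoeff e n) (negCoeff e n) t),
      pack (testVectors.map fun n =>
        bif es.all fun e' => Nat.beq (posCoeff e'.1 n) (negCoeff e'.1 n) then 128 else 0)) ::
      searchLevels es

/-- Whether every assignment of values makes some masked bit of the accumulator vanish. -/
def refutes : List (List ℕ × ℕ) → ℕ → Bool
  | [], _ => false
  | (cs, m) :: ls, acc =>
    cs.all fun c => !(Nat.beq ((acc + c) &&& m) m) || refutes ls (acc + c)

/-- The sum of the absolute values of the coefficients of the free entries. -/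
def coeffBound (n : ℕ) : ℕ :=
  (freeEntries.map fun e => shiftedTerm (posCoeff e n) (negCoeff e n) 1).sum

/-- The initial accumulator, which becomes `127` plus the values of the quadratic form at the test
vectors once all free entries are assigned. -/
def initialAcc : ℕ := pack (testVectors.map fun n => (127 + constTerm n - coeffBound n).toNat)

/-- The free entries with their possible values, increased by one. -/
def searchInput (r s r' s' : ℕ) : List ((ℕ × ℕ × ℕ × ℕ) × List ℕ) :=
  freeEntries.zip
    ([[r], [s], [r], [s], [r'], [s'], [r'], [s']] ++ List.replicate 21 [0, 1, 2])

set_option maxRecDepth 100000 in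
theorem refutes_all :
    [(1, 0, 1, 0), (1, 0, 0, 1), (0, 1, 1, 0), (0, 1, 0, 1)].all (fun p =>
      refutes (searchLevels (searchInput p.1 p.2.1 p.2.2.1 p.2.2.2)) initialAcc) = true := by
  decide +kernel

theorem pack_map_add (l : List ℕ) (f g : ℕ → ℕ) :
    pack (l.map f) + pack (l.map g) = pack (l.map fun n => f n + g n) := by
  induction l with
  | nil => rfl
  | cons n l ih =>
    simp only [List.map_cons, pack, ← ih]
    ring

theorem and_pack (l : List ℕ) (f m : ℕ → ℕ)
    (h : ∀ n ∈ l, f n < 256 ∧ (m n = 0 ∨ m n = 128 ∧ 128 ≤ f n)) :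
    pack (l.map f) &&& pack (l.map m) = pack (l.map m) := by
  have digits : ∀ d < 256, 128 ≤ d → d &&& 128 = 128 := by decide +kernel
  induction l with
  | nil => simp [pack]
  | cons n l ih =>
    obtain ⟨hf, hm⟩ := h n (by simp)
    have ih := ih fun n hn => h n (by simp [hn])
    simp only [List.map_cons, pack]
    have hm' : m n < 256 := by omega
    have hd : f n &&& m n = m n := by
      rcases hm with hm | ⟨hm, hf'⟩
      · simp [hm]
      · rw [hm, digits _ hf hf']
    set F := pack (l.map f)
    set M := pack (l.map m)
    rw [← Nat.mod_add_div ((f n + 256 * F) &&& (m n + 256 * M)) (2 ^ 8), Nat.and_mod_two_pow,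
      Nat.and_div_two_pow]
    have h1 : (f n + 256 * F) % 2 ^ 8 = f n := by omega
    have h2 : (m n + 256 * M) % 2 ^ 8 = m n := by omega
    have h3 : (f n + 256 * F) / 2 ^ 8 = F := by omega
    have h4 : (m n + 256 * M) / 2 ^ 8 = M := by omega
    rw [h1, h2, h3, h4, hd, ih]
    norm_num

/-- The total contribution of an assignment of values to the accumulator. -/
def total (n : ℕ) : List ((ℕ × ℕ × ℕ × ℕ) × List ℕ) → List ℕ → ℕ
  | e :: es, t :: ts => shiftedTerm (posCoeff e.1 n) (negCoeff e.1 n) t + total n es ts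
  | _, _ => 0

theorem total_eq_zero (n : ℕ) (es : List ((ℕ × ℕ × ℕ × ℕ) × List ℕ)) (ts : List ℕ)
    (h : ∀ e ∈ es, posCoeff e.1 n = negCoeff e.1 n) : total n es ts = 0 := by
  induction es generalizing ts with
  | nil => simp [total]
  | cons e es ih =>
    cases ts with
    | nil => simp [total]
    | cons t ts => simp [total, ih ts fun e he => h e (by simp [he]), h e (by simp), shiftedTerm]

/-- The search cannot refute an assignment with positive values at all test vectors. -/
theorem refutes_eq_false (es : List ((ℕ × ℕ × ℕ × ℕ) × List ℕ)) (ts : List ℕ) (d : ℕ → ℕ)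
    (ht : List.Forall₂ (fun e t => t ∈ e.2) es ts)
    (h : ∀ n ∈ testVectors, 128 ≤ d n + total n es ts ∧ d n + total n es ts < 256) :
    refutes (searchLevels es) (pack (testVectors.map d)) = false := by
  induction ht generalizing d with
  | nil => rfl
  | @cons e t es ts het _ ih =>
    obtain ⟨e, dom⟩ := e
    rw [searchLevels, refutes, List.all_eq_false]
    refine ⟨_, List.mem_map_of_mem het, ?_⟩
    rw [pack_map_add, ih _ fun n hn => by simpa [total, add_assoc] using h n hn, and_pack]
    · simp
    · intro n hn
      have := h n hn
      simp only [total] at this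
      refine ⟨by omega, ?_⟩
      by_cases hz : (es.all fun e' => Nat.beq (posCoeff e'.1 n) (negCoeff e'.1 n)) = true
      · have := total_eq_zero n es ts fun e he => by
          simpa using List.all_eq_true.1 hz e he
        exact Or.inr ⟨by rw [hz, cond_true], by omega⟩
      · simp [hz]

set_option maxRecDepth 100000 in
theorem testVectors_bounds : ∀ n ∈ testVectors,
    coeffBound n ≤ 127 + constTerm n ∧ constTerm n + coeffBound n ≤ 128 ∧
      (∃ i : Fin 9, coord n i ≠ 0) := by
  decide +kernel

/-- The value of the quadratic form at the vector encoded by `n`, given the free entries. -/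
def formValue (n : ℕ) (ys : List ℤ) : ℤ :=
  constTerm n +
    (List.zipWith (fun e y => ((posCoeff e n : ℤ) - negCoeff e n) * y) freeEntries ys).sum

theorem cast_shiftedTerm (p q : ℕ) {y : ℤ} (h : -1 ≤ y ∧ y ≤ 1) :
    (shiftedTerm p q (y + 1).toNat : ℤ) = shiftedTerm p q 1 + (p - q) * y ∧
      shiftedTerm p q (y + 1).toNat ≤ 2 * shiftedTerm p q 1 := by
  obtain rfl | rfl | rfl : y = -1 ∨ y = 0 ∨ y = 1 := by omega
  all_goals simp [shiftedTerm]; omega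

theorem cast_total (n : ℕ) (es : List (ℕ × ℕ × ℕ × ℕ)) (ys : List ℤ) (doms : List (List ℕ))
    (hy : ∀ y ∈ ys, -1 ≤ y ∧ y ≤ 1) (hes : es.length = ys.length) (hd : doms.length = ys.length) :
    (total n (es.zip doms) (ys.map fun y => (y + 1).toNat) : ℤ) =
        (es.map fun e => shiftedTerm (posCoeff e n) (negCoeff e n) 1).sum +
          (List.zipWith (fun e y => ((posCoeff e n : ℤ) - negCoeff e n) * y) es ys).sum ∧
      total n (es.zip doms) (ys.map fun y => (y + 1).toNat) ≤
        2 * (es.map fun e => shiftedTerm (posCoeff e n) (negCoeff e n) 1).sum := by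
  induction ys generalizing es doms with
  | nil =>
    obtain rfl := List.length_eq_zero_iff.1 hes
    simp [total]
  | cons y ys ih =>
    obtain ⟨e, es, rfl⟩ := List.exists_cons_of_length_eq_add_one hes
    obtain ⟨dom, doms, rfl⟩ := List.exists_cons_of_length_eq_add_one hd
    obtain ⟨h1, h2⟩ := ih es doms (fun y h => hy y (by simp [h])) (by simpa using hes)
      (by simpa using hd)
    obtain ⟨h3, h4⟩ := cast_shiftedTerm (posCoeff e n) (negCoeff e n) (hy y (by simp))
    simp only [List.zip_cons_cons, List.map_cons, total, List.sum_cons, List.zipWith_cons_cons,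
      Nat.cast_add, h1, h3]
    exact ⟨by ring, by omega⟩

/-- No assignment of values to the free entries makes the form positive at all test vectors. -/
theorem exists_formValue_nonpos (r s r' s' : ℕ) (ys : List ℤ)
    (hcase : (r, s, r', s') ∈ [(1, 0, 1, 0), (1, 0, 0, 1), (0, 1, 1, 0), (0, 1, 0, 1)])
    (hy : ∀ y ∈ ys, -1 ≤ y ∧ y ≤ 1)
    (hdom : List.Forall₂ (fun e t => t ∈ e.2) (searchInput r s r' s')
      (ys.map fun y => (y + 1).toNat)) :
    ∃ n ∈ testVectors, formValue n ys ≤ 0 := by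
  by_contra! hpos
  have hlen := hdom.length_eq
  simp [searchInput, freeEntries] at hlen
  have := List.all_eq_true.1 refutes_all _ hcase
  rw [initialAcc, refutes_eq_false _ _ _ hdom] at this
  · simp at this
  · intro n hn
    have hv := hpos n hn
    obtain ⟨b1, b2, -⟩ := testVectors_bounds n hn
    obtain ⟨h1, h2⟩ := cast_total n freeEntries ys
      ([[r], [s], [r], [s], [r'], [s'], [r'], [s']] ++ List.replicate 21 [0, 1, 2]) hy
      (by simp [freeEntries, ← hlen]) (by simp [← hlen])
    rw [searchInput]
    simp only [formValue, coeffBound] at *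
    omega

namespace IsRootArray

variable {h : Fin 4 → Fin 4 → Fin 4 → Fin 4 → ℤ}

theorem sum_block (H : IsRootArray h) (i j : Fin 4) :
    ∑ k : Fin 3, ∑ l : Fin 3, h i j k.castSucc l.castSucc = h i j 3 3 := by
  have r : ∀ k, ∑ l : Fin 3, h i j k l.castSucc = -h i j k 3 := fun k => by
    have := H.row_sum i j k
    rw [Fin.sum_univ_castSucc] at this
    exact eq_neg_of_add_eq_zero_left this
  have c := H.col_sum i j 3
  rw [Fin.sum_univ_castSucc] at c
  simp only [r, Finset.sum_neg_distrib]
  exact neg_eq_of_add_eq_zero_right c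

theorem sum_block_block (H : IsRootArray h) :
    ∑ i : Fin 3, ∑ j : Fin 3, ∑ k : Fin 3, ∑ l : Fin 3,
      h i.castSucc j.castSucc k.castSucc l.castSucc = 2 := by
  simp only [H.sum_block, H.symm _ _ 3 3, H.norm]

/-- The inner products in the order of `freeEntries`. -/
def entries (h : Fin 4 → Fin 4 → Fin 4 → Fin 4 → ℤ) : List ℤ :=
  freeEntries.map fun e => h (Fin.ofNat 4 (e.1 / 3)) (Fin.ofNat 4 (e.1 % 3))
    (Fin.ofNat 4 (e.2.1 / 3)) (Fin.ofNat 4 (e.2.1 % 3))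

/-- The value at a test vector is half the norm of a combination of the nine roots `h i j` with
`i, j < 3`. -/
theorem formValue_pos (H : IsRootArray h) {n : ℕ} (hn : ∃ i : Fin 9, coord n i ≠ 0) :
    0 < formValue n (entries h) := by
  have line_row : ∀ i, h i 0 i 1 + h i 0 i 2 + h i 1 i 2 = -2 := fun i => by
    obtain ⟨h1, h2, -⟩ := H.row_relations i
    rw [h2, h1]
  have line_col : ∀ j, h 0 j 1 j + h 0 j 2 j + h 1 j 2 j = -2 := fun j => by
    obtain ⟨h1, h2, -⟩ := H.transpose.row_relations j
    rw [h2, h1]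
  have total_sum := H.sum_block_block
  have pos := H.pos ![![coord n 0, coord n 1, coord n 2, 0], ![coord n 3, coord n 4, coord n 5, 0],
    ![coord n 6, coord n 7, coord n 8, 0], ![0, 0, 0, 0]] <| by
      obtain ⟨i, hi⟩ := hn
      refine ⟨![0, 0, 0, 1, 1, 1, 2, 2, 2] i, ![0, 1, 2, 0, 1, 2, 0, 1, 2] i, 3, 3, ?_⟩
      fin_cases i <;> simpa using hi
  simp only [Fin.sum_univ_three, Fin.sum_univ_four, Matrix.cons_val, Fin.castSucc_zero,
    Fin.castSucc_one, Fin.reduceCastSucc, mul_zero, zero_mul, add_zero] at pos total_sum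
  simp only [H.norm,
    H.symm 0 1 0 0, H.symm 0 2 0 0, H.symm 1 0 0 0, H.symm 1 1 0 0, H.symm 1 2 0 0,
    H.symm 2 0 0 0, H.symm 2 1 0 0, H.symm 2 2 0 0, H.symm 0 2 0 1, H.symm 1 0 0 1,
    H.symm 1 1 0 1, H.symm 1 2 0 1, H.symm 2 0 0 1, H.symm 2 1 0 1, H.symm 2 2 0 1,
    H.symm 1 0 0 2, H.symm 1 1 0 2, H.symm 1 2 0 2, H.symm 2 0 0 2, H.symm 2 1 0 2,
    H.symm 2 2 0 2, H.symm 1 1 1 0, H.symm 1 2 1 0, H.symm 2 0 1 0, H.symm 2 1 1 0,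
    H.symm 2 2 1 0, H.symm 1 2 1 1, H.symm 2 0 1 1, H.symm 2 1 1 1, H.symm 2 2 1 1,
    H.symm 2 0 1 2, H.symm 2 1 1 2, H.symm 2 2 1 2, H.symm 2 1 2 0, H.symm 2 2 2 0,
    H.symm 2 2 2 1] at pos total_sum
  have cross :
      h 0 0 1 1 + h 0 0 1 2 + h 0 0 2 1 + h 0 0 2 2 + h 0 1 1 0 + h 0 1 1 2 + h 0 1 2 0 +
      h 0 1 2 2 + h 0 2 1 0 + h 0 2 1 1 + h 0 2 2 0 + h 0 2 2 1 + h 1 0 2 1 + h 1 0 2 2 +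
      h 1 1 2 0 + h 1 1 2 2 + h 1 2 2 0 + h 1 2 2 1 = 4 := by
    linarith [line_row 0, line_row 1, line_row 2, line_col 0, line_col 1, line_col 2]
  simp only [formValue, entries, freeEntries, constTerm, List.map_cons, List.map_nil,
    List.zipWith_cons_cons, List.zipWith_nil_right, List.sum_cons, List.sum_nil, posCoeff, negCoeff]
  simp only [Nat.reduceDiv, Nat.reduceMod, Fin.reduceOfNat]
  push_cast
  have hd : ∀ i, (digit n i : ℤ) = coord n i + 4 := fun i => by simp [coord]
  simp only [hd]
  refine pos_of_mul_pos_right (a := 2) (pos.trans_eq ?_) (by norm_num)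
  linear_combination 2 * (coord n 1 * coord n 2 * line_row 0 + coord n 4 * coord n 5 * line_row 1 +
    coord n 6 * coord n 8 * line_row 2 + coord n 3 * coord n 6 * line_col 0 +
    coord n 4 * coord n 7 * line_col 1 + coord n 2 * coord n 8 * line_col 2 +
    coord n 0 * coord n 5 * cross)

theorem not_normalized (H : IsRootArray h) (hrow : ∀ j l, h 1 j 1 l = h 0 j 0 l)
    (hcol : ∀ i k, h i 1 k 1 = h i 0 k 0) (h1 : h 0 0 0 1 = 0 ∨ h 0 0 0 2 = 0)
    (h2 : h 0 0 1 0 = 0 ∨ h 0 0 2 0 = 0) : False := by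
  have bound : ∀ y ∈ entries h, -1 ≤ y ∧ y ≤ 1 := by
    have hne : ∀ e ∈ freeEntries,
        ¬((Fin.ofNat 4 (e.1 / 3)) = (Fin.ofNat 4 (e.2.1 / 3)) ∧
          (Fin.ofNat 4 (e.1 % 3)) = (Fin.ofNat 4 (e.2.1 % 3))) := by
      decide +kernel
    intro y hy
    obtain ⟨e, he, rfl⟩ := List.mem_map.1 hy
    exact H.bound _ _ _ _ (hne e he)
  have dom : ∀ y : ℤ, -1 ≤ y ∧ y ≤ 1 → (y + 1).toNat ∈ [0, 1, 2] := fun y hy => by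
    obtain rfl | rfl | rfl : y = -1 ∨ y = 0 ∨ y = 1 := by omega
    all_goals decide
  have b : ∀ i j k l, ¬(i = k ∧ j = l) → (h i j k l + 1).toNat ∈ [0, 1, 2] :=
    fun i j k l hne => dom _ (H.bound i j k l hne)
  have hcase : ((h 0 0 0 1 + 1).toNat, (h 0 0 0 2 + 1).toNat, (h 0 0 1 0 + 1).toNat,
      (h 0 0 2 0 + 1).toNat) ∈ [(1, 0, 1, 0), (1, 0, 0, 1), (0, 1, 1, 0), (0, 1, 0, 1)] := by
    have r := (H.row_relations 0).1
    have c := (H.transpose.row_relations 0).1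
    have br := fun l hl => H.bound 0 0 0 l hl
    have bc := fun k hk => H.bound 0 0 k 0 hk
    have hr : h 0 0 0 1 = 0 ∧ h 0 0 0 2 = -1 ∨ h 0 0 0 1 = -1 ∧ h 0 0 0 2 = 0 := by
      have := br 1 (by simp)
      have := br 2 (by simp)
      have := br 3 (by simp)
      omega
    have hc : h 0 0 1 0 = 0 ∧ h 0 0 2 0 = -1 ∨ h 0 0 1 0 = -1 ∧ h 0 0 2 0 = 0 := by
      have := bc 1 (by simp)
      have := bc 2 (by simp)
      have := bc 3 (by simp)
      omega
    rcases hr with ⟨e1, e2⟩ | ⟨e1, e2⟩ <;> rcases hc with ⟨e3, e4⟩ | ⟨e3, e4⟩ <;>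
      rw [e1, e2, e3, e4] <;> decide
  have hdom : List.Forall₂ (fun e t => t ∈ e.2)
      (searchInput (h 0 0 0 1 + 1).toNat (h 0 0 0 2 + 1).toNat (h 0 0 1 0 + 1).toNat
        (h 0 0 2 0 + 1).toNat) ((entries h).map fun y => (y + 1).toNat) := by
    simp only [entries, freeEntries, searchInput, List.map_cons, List.map_nil, List.cons_append,
      List.nil_append, List.replicate, List.zip_cons_cons, List.zip_nil_right,
      List.forall₂_cons, List.forall₂_nil_left_iff, Nat.reduceDiv, Nat.reduceMod, Fin.reduceOfNat,
      hrow, hcol, List.mem_singleton, true_and, and_true]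
    and_intros <;> exact b _ _ _ _ (by decide)
  obtain ⟨n, hn, hv⟩ := exists_formValue_nonpos _ _ _ _ _ hcase bound hdom
  exact (H.formValue_pos (testVectors_bounds n hn).2.2).not_ge hv

end IsRootArray

/-- The vertices of a simplex centred at the origin. -/
def simplexVec : Fin 4 → Fin 3 → ℤ := ![![1, 0, 0], ![0, 1, 0], ![0, 0, 1], ![-1, -1, -1]]

/-- The tensor products of two simplex vectors, with the coordinates numbered in such a way that the
sum of the matrices `d dᵀ` over these sixteen vectors `d` is `CartanC`. -/
def rootVec (i j : Fin 4) (m : Fin 9) : ℤ :=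
  simplexVec i (![0, 0, 0, 1, 2, 1, 2, 1, 2] m) * simplexVec j (![0, 1, 2, 2, 1, 0, 0, 1, 2] m)

theorem sum_rootVec_mul (m n : Fin 9) :
    ∑ p : Fin 4 × Fin 4, rootVec p.1 p.2 m * rootVec p.1 p.2 n = CartanC m n := by
  have key : ∀ r : Fin 9 × Fin 9, ∑ p : Fin 4 × Fin 4,
      rootVec p.1 p.2 r.1 * rootVec p.1 p.2 r.2 = CartanC r.1 r.2 := by
    decide +kernel
  exact key (m, n)

theorem sum_rootVec_right (i : Fin 4) : ∑ j, rootVec i j = 0 := by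
  revert i
  decide +kernel

theorem sum_rootVec_left (j : Fin 4) : ∑ i, rootVec i j = 0 := by
  revert j
  decide +kernel

theorem rootVec_add_sub_ne_zero : ∀ i j k l : Fin 4, ¬(i = k ∧ j = l) →
    rootVec i j + rootVec k l ≠ 0 ∧ rootVec i j - rootVec k l ≠ 0 := by
  decide +kernel

theorem rootVec_ne_zero : ∀ i j : Fin 4, rootVec i j ≠ 0 := by
  decide +kernel

theorem eq_of_sum_smul_rootVec_eq_zero {a : Fin 4 → Fin 4 → ℤ}
    (h : ∑ i, ∑ j, a i j • rootVec i j = 0) (i j k l : Fin 4) :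
    a i j + a k l = a i l + a k j := by
  have key : ∀ i j, a i j = a i 3 + a 3 j - a 3 3 := by
    have c := fun m => congrFun h m
    simp only [Fin.sum_univ_four, Pi.add_apply, Pi.smul_apply, rootVec, simplexVec, smul_eq_mul,
      Pi.zero_apply] at c
    have c0 := c 0
    have c1 := c 1
    have c2 := c 2
    have c3 := c 3
    have c4 := c 4
    have c5 := c 5
    have c6 := c 6
    have c7 := c 7
    have c8 := c 8
    simp at c0 c1 c2 c3 c4 c5 c6 c7 c8
    intro i j
    fin_cases i <;> fin_cases j <;> simp <;> omega
  rw [key i j, key k l, key i l, key k j]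
  ring

/-- The polar form of the quadratic form with upper-triangular coefficients `q`. -/
noncomputable def polarForm {l : ℕ} (q : Fin l → Fin l → ℤ) : LinearMap.BilinForm ℤ (Fin l → ℤ) :=
  Matrix.toBilin' (Matrix.of fun m n => (if m ≤ n then q m n else 0) + if n ≤ m then q n m else 0)

theorem polarForm_self {l : ℕ} (q : Fin l → Fin l → ℤ) (x : Fin l → ℤ) :
    polarForm q x x = 2 * ∑ m, ∑ n, if m ≤ n then q m n * x m * x n else 0 := by
  simp only [polarForm, Matrix.toBilin'_apply, Matrix.of_apply, mul_add, add_mul,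
    Finset.sum_add_distrib]
  rw [Finset.sum_comm (f := fun m n => x m * (if n ≤ m then q n m else 0) * x n), two_mul]
  congr 1 <;> refine Finset.sum_congr rfl fun m _ => Finset.sum_congr rfl fun n _ => ?_ <;>
    split_ifs <;> ring

theorem polarForm_comm {l : ℕ} (q : Fin l → Fin l → ℤ) (x y : Fin l → ℤ) :
    polarForm q x y = polarForm q y x := by
  simp only [polarForm, Matrix.toBilin'_apply, Matrix.of_apply]
  rw [Finset.sum_comm]
  refine Finset.sum_congr rfl fun m _ => Finset.sum_congr rfl fun n _ => ?_
  ring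

theorem QFPosDef.int_pos {l : ℕ} {q : Fin l → Fin l → ℤ} (hq : QFPosDef q) {x : Fin l → ℤ}
    (hx : x ≠ 0) : 0 < ∑ m, ∑ n, if m ≤ n then q m n * x m * x n else 0 := by
  have := hq (fun i => x i) fun h => hx <| funext fun i => by simpa using congrFun h i
  exact_mod_cast this

theorem QFPosDef.isRootArray {q : Fin 9 → Fin 9 → ℤ} (hq : QFPosDef q)
    (hC : (∑ i, ∑ j, if i ≤ j then q i j * CartanC i j else 0) ≤ 16) :
    IsRootArray fun i j k l => polarForm q (rootVec i j) (rootVec k l) := by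
  have hpos : ∀ x, x ≠ 0 → 0 < polarForm q x x := fun x hx => by
    rw [polarForm_self]
    exact mul_pos two_pos (hq.int_pos hx)
  have hnorm : ∀ i j, polarForm q (rootVec i j) (rootVec i j) = 2 := by
    set Q : Fin 4 × Fin 4 → ℤ := fun p =>
      ∑ m, ∑ n, if m ≤ n then q m n * rootVec p.1 p.2 m * rootVec p.1 p.2 n else 0
    have h1 : ∀ p, 1 ≤ Q p := fun p => hq.int_pos (rootVec_ne_zero _ _)
    have hsum : ∑ p, Q p ≤ 16 := by
      refine le_of_eq_of_le ?_ hC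
      rw [Finset.sum_comm]
      refine Finset.sum_congr rfl fun m _ => ?_
      rw [Finset.sum_comm]
      refine Finset.sum_congr rfl fun n _ => ?_
      split_ifs
      · simp only [mul_assoc, ← Finset.mul_sum, sum_rootVec_mul]
      · simp
    intro i j
    rw [polarForm_self]
    have hle := Finset.single_le_sum (f := fun p => Q p - 1) (fun p _ => sub_nonneg.2 (h1 p))
      (Finset.mem_univ (i, j))
    rw [Finset.sum_sub_distrib] at hle
    have h2 := h1 (i, j)
    simp at hle
    change 2 * Q (i, j) = 2
    omega
  refine ⟨hnorm, fun _ _ _ _ => polarForm_comm _ _ _, fun i j k l hne => ?_, fun i j k => ?_,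
    fun i j l => ?_, fun a ha => ?_⟩
  · obtain ⟨hadd, hsub⟩ := rootVec_add_sub_ne_zero i j k l hne
    have h1 := hpos _ hadd
    have h2 := hpos _ hsub
    simp only [map_add, map_sub, LinearMap.add_apply, LinearMap.sub_apply, hnorm,
      polarForm_comm q (rootVec k l) (rootVec i j)] at h1 h2
    omega
  · rw [← map_sum, sum_rootVec_right, map_zero]
  · rw [← map_sum, sum_rootVec_left, map_zero]
  · obtain ⟨i, j, k, l, hne⟩ := ha
    have := hpos (∑ i, ∑ j, a i j • rootVec i j) fun h =>
      hne (eq_of_sum_smul_rootVec_eq_zero h i j k l)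
    refine this.trans_eq ?_
    simp only [map_sum, LinearMap.sum_apply, map_smul, LinearMap.smul_apply, smul_eq_mul,
      Finset.mul_sum]
    refine Finset.sum_congr rfl fun i _ => Finset.sum_congr rfl fun j _ =>
      Finset.sum_congr rfl fun k _ => Finset.sum_congr rfl fun l _ => ?_
    rw [polarForm_comm]
    ring

/-- There is no positive definite integral quadratic form
`q = Σ_{1 ≤ i ≤ j ≤ 9} q_{ij} x_i x_j` with `Σ_{1 ≤ i ≤ j ≤ 9} q_{ij} C_{ij} ≤ 16`
for the Cartan matrix `C` above. -/
theorem stmt8 :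
    ¬ ∃ q : Fin 9 → Fin 9 → ℤ, QFPosDef q ∧
      (∑ i, ∑ j, if i ≤ j then q i j * CartanC i j else 0) ≤ 16 := by
  rintro ⟨q, hq, hC⟩
  obtain ⟨g, hg, hrow, hcol, h1, h2⟩ := (hq.isRootArray hC).exists_normalized
  exact hg.not_normalized hrow hcol h1 h2
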